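/- Let Δ ≥ 4 and k ≥ 1 be integers and set n = Δk + 1. Then there exists a tree T on n vertices with maximum degree Δ such that σ(T) = Σ_{uv ∈ E(T)} (d(u) − d(v))² = (4Δ−6)·n + (Δ²−6Δ+3+6/Δ)·(n−1); moreover, any such tree has k(Δ−2)+2 vertices of degree 1, k−1 vertices of degree 2, k vertices of degree Δ, and every edge joins a vertex of degree 1 or degree 2 to a vertex of degree Δ. -/

import Mathlib

open Finset
open scoped Classical in
lemma edge_sum_aux {V : Type} [Fintype V] (G : SimpleGraph V) (f : V → ℝ) :
    ∑ e ∈ G.edgeFinset, Sym2.lift ⟨fun u v => f u + f v, by intro a b; ring⟩ e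
      = ∑ v, (G.degree v : ℝ) * f v := by
  have h1 : ∀ v, (G.degree v : ℝ) * f v = ∑ e ∈ G.edgeFinset, if v ∈ e then f v else 0 := by
    intro v
    rw [← Finset.sum_filter, Finset.sum_const, ← G.incidenceFinset_eq_filter,
      G.card_incidenceFinset_eq_degree, nsmul_eq_mul]
  simp_rw [h1]
  rw [Finset.sum_comm]
  refine Finset.sum_congr rfl fun e he => ?_
  induction e with
  | h a b =>
    have hab : a ≠ b := by
      rw [SimpleGraph.mem_edgeFinset, SimpleGraph.mem_edgeSet] at he
      exact he.ne
    simp only [Sym2.lift_mk, Sym2.mem_iff]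
    rw [← Finset.sum_filter]
    have : (Finset.univ.filter fun v => v = a ∨ v = b) = {a, b} := by
      ext v; simp
    rw [this, Finset.sum_pair hab]

/-- gap with larger degree `Δ` -/
lemma gap_top (D i : ℝ) (hD : 4 ≤ D) (hi : 1 ≤ i) :
    (4 * D - 6) * (1 / i + 1 / D) + (D ^ 2 - 6 * D + 3 + 6 / D) - (i - D) ^ 2
      = (i - 1) * (i - 2) * (2 * D - 3 - i) / i := by
  have : i ≠ 0 := by positivity
  have : D ≠ 0 := by positivity
  field_simp
  ring

lemma gap_aux (Δ i j : ℕ) (hΔ : 4 ≤ Δ) (hi : 1 ≤ i) (hij : i ≤ j) (hj : j ≤ Δ) :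
    0 ≤ (4 * (Δ : ℝ) - 6) * (1 / (i : ℝ) + 1 / (j : ℝ))
        + ((Δ : ℝ) ^ 2 - 6 * (Δ : ℝ) + 3 + 6 / (Δ : ℝ)) - ((i : ℝ) - (j : ℝ)) ^ 2 ∧
    ((4 * (Δ : ℝ) - 6) * (1 / (i : ℝ) + 1 / (j : ℝ))
        + ((Δ : ℝ) ^ 2 - 6 * (Δ : ℝ) + 3 + 6 / (Δ : ℝ)) - ((i : ℝ) - (j : ℝ)) ^ 2 = 0 →
      (i = 1 ∨ i = 2) ∧ j = Δ) := by
  have hΔ' : (4 : ℝ) ≤ Δ := by exact_mod_cast hΔ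
  have hi' : (1 : ℝ) ≤ i := by exact_mod_cast hi
  have hij' : (i : ℝ) ≤ j := by exact_mod_cast hij
  have hj' : (j : ℝ) ≤ Δ := by exact_mod_cast hj
  have e := gap_top Δ i hΔ' hi'
  have h12 : (0 : ℝ) ≤ (i - 1) * (i - 2) := by
    rcases Nat.lt_or_ge i 2 with h | h
    · have : i = 1 := by omega
      subst this; norm_num
    · have : (2 : ℝ) ≤ i := by exact_mod_cast h
      nlinarith
  have hpos : (0 : ℝ) < 2 * Δ - 3 - i := by linarith
  have hnn : (0 : ℝ) ≤ (i - 1) * (i - 2) * (2 * Δ - 3 - i) / i := by positivity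
  have hA : (0 : ℝ) < 4 * Δ - 6 := by linarith
  have hinv : 1 / (Δ : ℝ) ≤ 1 / (j : ℝ) := one_div_le_one_div_of_le (by linarith) hj'
  have hm := mul_le_mul_of_nonneg_left hinv hA.le
  have hsq : ((i : ℝ) - j) ^ 2 ≤ (i - Δ) ^ 2 := by nlinarith
  refine ⟨by nlinarith, fun h0 => ?_⟩
  have h1 : ((i : ℝ) - j) ^ 2 = (i - Δ) ^ 2 := by nlinarith
  have hjΔ : (j : ℝ) = Δ := by
    rcases eq_or_lt_of_le hj' with h | h
    · exact h
    · nlinarith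
  refine ⟨?_, by exact_mod_cast hjΔ⟩
  rw [hjΔ, e] at h0
  have hi0 : (i : ℝ) ≠ 0 := by positivity
  rw [div_eq_zero_iff] at h0
  have := h0.resolve_right hi0
  rcases mul_eq_zero.1 this with h | h
  · rcases mul_eq_zero.1 h with h | h
    · left; exact_mod_cast (sub_eq_zero.1 h)
    · right; exact_mod_cast (sub_eq_zero.1 h)
  · linarith

lemma gap_full (Δ i j : ℕ) (hΔ : 4 ≤ Δ) (hi : 1 ≤ i) (hj : 1 ≤ j) (hi2 : i ≤ Δ) (hj2 : j ≤ Δ) :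
    0 ≤ (4 * (Δ : ℝ) - 6) * (1 / (i : ℝ) + 1 / (j : ℝ))
        + ((Δ : ℝ) ^ 2 - 6 * (Δ : ℝ) + 3 + 6 / (Δ : ℝ)) - ((i : ℝ) - (j : ℝ)) ^ 2 ∧
    ((4 * (Δ : ℝ) - 6) * (1 / (i : ℝ) + 1 / (j : ℝ))
        + ((Δ : ℝ) ^ 2 - 6 * (Δ : ℝ) + 3 + 6 / (Δ : ℝ)) - ((i : ℝ) - (j : ℝ)) ^ 2 = 0 →
      ((i = 1 ∨ i = 2) ∧ j = Δ) ∨ ((j = 1 ∨ j = 2) ∧ i = Δ)) := by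
  rcases le_total i j with h | h
  · obtain ⟨a, b⟩ := gap_aux Δ i j hΔ hi h hj2
    exact ⟨a, fun h => Or.inl (b h)⟩
  · obtain ⟨a, b⟩ := gap_aux Δ j i hΔ hj h hi2
    have : ((j : ℝ) - i) ^ 2 = (i - j) ^ 2 := by ring
    rw [this, add_comm (1 / (j : ℝ))] at a b
    exact ⟨a, fun h => Or.inr (b h)⟩

lemma gap_zero (Δ i j : ℕ) (hΔ : 4 ≤ Δ)
    (h : ((i = 1 ∨ i = 2) ∧ j = Δ) ∨ ((j = 1 ∨ j = 2) ∧ i = Δ)) :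
    (4 * (Δ : ℝ) - 6) * (1 / (i : ℝ) + 1 / (j : ℝ))
        + ((Δ : ℝ) ^ 2 - 6 * (Δ : ℝ) + 3 + 6 / (Δ : ℝ)) - ((i : ℝ) - (j : ℝ)) ^ 2 = 0 := by
  have hΔ' : (Δ : ℝ) ≠ 0 := by
    have : (4 : ℝ) ≤ Δ := by exact_mod_cast hΔ
    positivity
  rcases h with ⟨h | h, h'⟩ | ⟨h | h, h'⟩ <;> subst h <;> subst h' <;> push_cast <;> field_simp <;> ring

open scoped Classical in
/-- The gap between the bound and `σ` is the sum of edge gaps. -/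
lemma sigma_gap {V : Type} [Fintype V] (G : SimpleGraph V) (hT : G.IsTree)
    (hd : ∀ v, 1 ≤ G.degree v) (A B : ℝ) :
    ∑ e ∈ G.edgeFinset, Sym2.lift ⟨fun u v => A * (1 / (G.degree u : ℝ) + 1 / (G.degree v : ℝ)) + B
        - ((G.degree u : ℝ) - (G.degree v : ℝ)) ^ 2, by intro a b; ring⟩ e
      = A * (Fintype.card V : ℝ) + B * ((Fintype.card V : ℝ) - 1)
        - ∑ e ∈ G.edgeFinset,
            Sym2.lift ⟨fun u v => ((G.degree u : ℝ) - (G.degree v : ℝ)) ^ 2,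
              by intro a b; ring⟩ e := by
  have hE := hT.card_edgeFinset
  have h1 := edge_sum_aux G (fun v => 1 / (G.degree v : ℝ))
  have h2 : ∑ v, (G.degree v : ℝ) * (1 / (G.degree v : ℝ)) = Fintype.card V := by
    rw [Finset.sum_congr rfl (g := fun _ => (1 : ℝ))]
    · simp
    · intro v _
      have : (G.degree v : ℝ) ≠ 0 := by
        have := hd v
        exact_mod_cast (by omega : G.degree v ≠ 0)
      field_simp
  rw [h2] at h1
  have hE' : (Fintype.card V : ℝ) - 1 = (G.edgeFinset.card : ℝ) := by
    rw [← hE]; push_cast; ring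
  rw [hE', ← h1, Finset.mul_sum, mul_comm B, ← nsmul_eq_mul, ← Finset.sum_const,
    ← Finset.sum_add_distrib, ← Finset.sum_sub_distrib]
  refine Finset.sum_congr rfl fun e _ => ?_
  induction e with
  | h a b => simp only [Sym2.lift_mk]

open scoped Classical in
lemma tree_structure (Δ k : ℕ) (hΔ : 4 ≤ Δ) (hk : 1 ≤ k) (V : Type) [Fintype V]
    (G : SimpleGraph V) (hc : Fintype.card V = Δ * k + 1) (hT : G.IsTree)
    (hpos : ∀ v, 1 ≤ G.degree v)
    (hadj : ∀ u v, G.Adj u v → ((G.degree u = 1 ∨ G.degree u = 2) ∧ G.degree v = Δ)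
              ∨ ((G.degree v = 1 ∨ G.degree v = 2) ∧ G.degree u = Δ)) :
    (Finset.univ.filter (fun v => G.degree v = 1)).card = k * (Δ - 2) + 2
          ∧ (Finset.univ.filter (fun v => G.degree v = 2)).card = k - 1
          ∧ (Finset.univ.filter (fun v => G.degree v = Δ)).card = k := by
  have hE := hT.card_edgeFinset
  have hcase : ∀ v, G.degree v = 1 ∨ G.degree v = 2 ∨ G.degree v = Δ := by
    intro v
    obtain ⟨w, hw⟩ := (G.degree_pos_iff_exists_adj v).1 (hpos v)
    rcases hadj v w hw with h | h <;> tauto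
  have h1 := edge_sum_aux G (fun v => if G.degree v = Δ then 1 else 0)
  have h2 : ∑ v, (G.degree v : ℝ) * (if G.degree v = Δ then 1 else 0)
      = (Δ : ℝ) * (Finset.univ.filter (fun v => G.degree v = Δ)).card := by
    rw [Finset.card_filter]; push_cast
    rw [Finset.mul_sum]
    refine Finset.sum_congr rfl fun v _ => ?_
    split_ifs with h <;> simp [h]
  have h3 : ∑ e ∈ G.edgeFinset, Sym2.lift ⟨fun u v => (if G.degree u = Δ then (1 : ℝ) else 0)
      + (if G.degree v = Δ then (1 : ℝ) else 0), by intro a b; ring⟩ e = (Δ * k : ℕ) := by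
    have : (Δ * k : ℕ) = G.edgeFinset.card := by omega
    rw [this, Finset.card_eq_sum_ones]
    push_cast
    refine Finset.sum_congr rfl fun e he => ?_
    induction e with
    | h a b =>
      rw [SimpleGraph.mem_edgeFinset, SimpleGraph.mem_edgeSet] at he
      simp only [Sym2.lift_mk]
      rcases hadj a b he with ⟨h, h'⟩ | ⟨h, h'⟩
      · have : G.degree a ≠ Δ := by omega
        simp [this, h']
      · have : G.degree b ≠ Δ := by omega
        simp [this, h']
  have hkk : (Finset.univ.filter (fun v => G.degree v = Δ)).card = k := by
    have : Δ * (Finset.univ.filter (fun v => G.degree v = Δ)).card = Δ * k := by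
      have h := h3.symm.trans (h1.trans h2)
      exact_mod_cast h.symm
    exact Nat.eq_of_mul_eq_mul_left (by omega) this
  have hn : (Finset.univ.filter (fun v => G.degree v = 1)).card
      + (Finset.univ.filter (fun v => G.degree v = 2)).card
      + (Finset.univ.filter (fun v => G.degree v = Δ)).card = Δ * k + 1 := by
    rw [← hc, Finset.card_filter, Finset.card_filter, Finset.card_filter, ← Finset.sum_add_distrib,
      ← Finset.sum_add_distrib, Fintype.card, Finset.card_eq_sum_ones]
    refine Finset.sum_congr rfl fun v _ => ?_
    rcases hcase v with h | h | h <;> rw [h] <;> split_ifs <;> omega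
  have hs : (Finset.univ.filter (fun v => G.degree v = 1)).card
      + 2 * (Finset.univ.filter (fun v => G.degree v = 2)).card
      + Δ * (Finset.univ.filter (fun v => G.degree v = Δ)).card = 2 * (Δ * k) := by
    have : Δ * k = G.edgeFinset.card := by omega
    rw [this, ← G.sum_degrees_eq_twice_card_edges]
    rw [Finset.card_filter, Finset.card_filter, Finset.card_filter, Finset.mul_sum, Finset.mul_sum,
      ← Finset.sum_add_distrib, ← Finset.sum_add_distrib]
    refine Finset.sum_congr rfl fun v _ => ?_
    rcases hcase v with h | h | h <;> rw [h] <;> split_ifs <;> omega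
  rw [hkk] at hn hs
  obtain ⟨m, rfl⟩ : ∃ m, Δ = m + 2 := ⟨Δ - 2, by omega⟩
  refine ⟨?_, ?_, hkk⟩
  · simp only [Nat.add_sub_cancel]
    have : k * m + 2 * k = (m + 2) * k := by ring
    omega
  · omega


/-- parent function of the extremal caterpillar-like tree -/
def extPar (D i : ℕ) : ℕ := if (i - 1) % D = 0 then i - 1 else D * ((i - 1) / D) + 1

/-- the extremal tree -/
def extTree (D k : ℕ) : SimpleGraph (Fin (D * k + 1)) where
  Adj u v := u ≠ v ∧ ((u.val ≠ 0 ∧ v.val = extPar D u.val) ∨ (v.val ≠ 0 ∧ u.val = extPar D v.val))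
  symm := ⟨fun u v h => ⟨h.1.symm, h.2.symm⟩⟩
  loopless := ⟨fun u h => h.1 rfl⟩

lemma extPar_lt (D i : ℕ) (hD : 4 ≤ D) (hi : i ≠ 0) : extPar D i < i := by
  unfold extPar
  have := Nat.div_add_mod (i - 1) D
  split_ifs with h <;> omega

lemma extTree_conn (D k : ℕ) (hD : 4 ≤ D) : (extTree D k).Connected := by
  have key : ∀ m : ℕ, ∀ h : m < D * k + 1, (extTree D k).Reachable ⟨m, h⟩ ⟨0, by omega⟩ := by
    intro m
    induction m using Nat.strong_induction_on with
    | _ m ih =>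
      intro h
      by_cases hm : m = 0
      · subst hm; exact SimpleGraph.Reachable.refl _
      · have hp := extPar_lt D m hD hm
        refine SimpleGraph.Reachable.trans (SimpleGraph.Adj.reachable ?_) (ih (extPar D m) hp (by omega))
        refine ⟨?_, Or.inl ⟨hm, rfl⟩⟩
        intro h; have := congrArg Fin.val h; simp at this; omega
  haveI : Nonempty (Fin (D * k + 1)) := ⟨⟨0, by omega⟩⟩
  exact ⟨fun u v => (key u.1 u.2).trans (key v.1 v.2).symm⟩

open scoped Classical in
lemma extTree_isTree (D k : ℕ) (hD : 4 ≤ D) : (extTree D k).IsTree := by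
  rw [SimpleGraph.isTree_iff_connected_and_card]
  refine ⟨extTree_conn D k hD, ?_⟩
  have h1 := (extTree_conn D k hD).card_vert_le_card_edgeSet_add_one
  refine le_antisymm ?_ h1
  rw [Nat.card_eq_fintype_card, ← SimpleGraph.edgeFinset_card, Nat.card_eq_fintype_card, Fintype.card_fin]
  have hsub : (extTree D k).edgeFinset ⊆ (Finset.univ.filter (fun v : Fin (D * k + 1) => v.val ≠ 0)).image
      (fun v => s(v, ⟨extPar D v.val % (D * k + 1), Nat.mod_lt _ (by omega)⟩)) := by
    intro e he
    induction e with
    | h a b =>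
      rw [SimpleGraph.mem_edgeFinset, SimpleGraph.mem_edgeSet] at he
      rw [Finset.mem_image]
      rcases he.2 with ⟨h0, h⟩ | ⟨h0, h⟩
      · refine ⟨a, Finset.mem_filter.2 ⟨Finset.mem_univ _, h0⟩, ?_⟩
        congr 1
        refine Fin.ext ?_
        simp only [← h]; exact Nat.mod_eq_of_lt b.2
      · refine ⟨b, Finset.mem_filter.2 ⟨Finset.mem_univ _, h0⟩, ?_⟩
        rw [Sym2.eq_swap]
        congr 1
        refine Fin.ext ?_
        simp only [← h]; exact Nat.mod_eq_of_lt a.2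
  have h2 := (Finset.card_le_card hsub).trans Finset.card_image_le
  have h3 : (Finset.univ.filter (fun v : Fin (D * k + 1) => v.val ≠ 0)).card ≤ D * k := by
    have : (Finset.univ.filter (fun v : Fin (D * k + 1) => v.val ≠ 0)) ⊆ Finset.univ.erase ⟨0, by omega⟩ := by
      intro v hv
      simp at hv
      simp [Fin.ext_iff, hv]
    have := Finset.card_le_card this
    simpa using this
  omega

/-- relation: `c` is a center and `w` is attached to it -/
def extRel (D c w : ℕ) : Prop := c % D = 1 ∧ w ≠ c ∧ c ≤ w + 1 ∧ w < c + D

lemma extPar_rel (D i : ℕ) (hD : 4 ≤ D) (hi : i ≠ 0) :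
    if i % D = 1 then extRel D i (extPar D i) else extRel D (extPar D i) i := by
  unfold extRel extPar
  have h1 := Nat.div_add_mod (i - 1) D
  have h2 := Nat.mod_lt (i - 1) (show D > 0 by omega)
  by_cases h : (i - 1) % D = 0
  · have : i % D = 1 := by
      have : i = 1 + D * ((i - 1) / D) := by omega
      rw [this, Nat.add_mul_mod_self_left, Nat.mod_eq_of_lt (by omega)]
    rw [if_pos this, if_pos h]
    omega
  · have hne : i % D ≠ 1 := by
      intro h3
      have h4 := Nat.div_add_mod i D
      apply h
      have : i - 1 = D * (i / D) := by omega
      rw [this, Nat.mul_mod_right]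
    rw [if_neg hne, if_neg h]
    refine ⟨?_, ?_, by omega, by omega⟩
    · rw [add_comm, Nat.add_mul_mod_self_left, Nat.mod_eq_of_lt (by omega)]
    · intro h3; apply hne
      rw [h3, add_comm, Nat.add_mul_mod_self_left, Nat.mod_eq_of_lt (by omega)]

lemma center_unique (D c d : ℕ) (hD : 4 ≤ D) (hc : c % D = 1) (hd : d % D = 1)
    (h : c < d + D) (h' : d < c + D) : c = d := by
  have h1 := Nat.div_add_mod c D
  have h2 := Nat.div_add_mod d D
  have : c / D = d / D := by
    apply le_antisymm
    · by_contra hh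
      have := Nat.mul_le_mul_left D (show d / D + 1 ≤ c / D by omega)
      rw [mul_add] at this
      omega
    · by_contra hh
      have := Nat.mul_le_mul_left D (show c / D + 1 ≤ d / D by omega)
      rw [mul_add] at this
      omega
  rw [this] at h1
  omega

lemma rel_par (D c w : ℕ) (hD : 4 ≤ D) (h : extRel D c w) :
    (c ≠ 0 ∧ w = extPar D c) ∨ (w ≠ 0 ∧ c = extPar D w) := by
  obtain ⟨h1, h2, h3, h4⟩ := h
  have hc := Nat.div_add_mod c D
  have hc0 : c ≠ 0 := by rintro rfl; simp at h1
  rcases Nat.lt_or_ge w c with h | h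
  · left
    refine ⟨hc0, ?_⟩
    unfold extPar
    have : c - 1 = D * (c / D) := by omega
    rw [if_pos]
    · omega
    · rw [this, Nat.mul_mod_right]
  · right
    have hw0 : w ≠ 0 := by omega
    refine ⟨hw0, ?_⟩
    have hw : w - 1 = (w - c) + D * (c / D) := by omega
    unfold extPar
    rw [hw, Nat.add_mul_mod_self_left, Nat.mod_eq_of_lt (by omega), if_neg (by omega),
      Nat.add_mul_div_left _ _ (by omega), Nat.div_eq_of_lt (by omega), Nat.zero_add]
    omega

lemma extTree_adj (D k : ℕ) (hD : 4 ≤ D) (u v : Fin (D * k + 1)) :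
    (extTree D k).Adj u v ↔ extRel D u.val v.val ∨ extRel D v.val u.val := by
  constructor
  · rintro ⟨_, ⟨h0, h⟩ | ⟨h0, h⟩⟩
    · have := extPar_rel D u.val hD h0
      rw [← h] at this
      split_ifs at this <;> tauto
    · have := extPar_rel D v.val hD h0
      rw [← h] at this
      split_ifs at this <;> tauto
  · rintro (h | h)
    · refine ⟨fun e => h.2.1 (by rw [e]), rel_par D _ _ hD h⟩
    · refine ⟨fun e => h.2.1 (by rw [e]), (rel_par D _ _ hD h).symm⟩

lemma rel_not_center (D c w : ℕ) (hD : 4 ≤ D) (h : extRel D c w) : w % D ≠ 1 := fun hw =>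
  h.2.1 (center_unique D w c hD hw h.1 h.2.2.2 (by have := h.2.2.1; omega))

open scoped Classical in
lemma extTree_degree_center (D k : ℕ) (hD : 4 ≤ D) (u : Fin (D * k + 1)) (hu : u.val % D = 1) :
    (extTree D k).degree u = D := by
  have hc := Nat.div_add_mod u.val D
  have hlt : u.val + D ≤ D * k + 1 := by
    have h1 := u.2
    have : u.val / D < k := by
      by_contra hh
      have := Nat.mul_le_mul_left D (show k ≤ u.val / D by omega)
      omega
    have := Nat.mul_le_mul_left D (show u.val / D + 1 ≤ k by omega)
    rw [mul_add] at this
    omega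
  rw [← SimpleGraph.card_neighborFinset_eq_degree, ← Finset.card_map Fin.valEmbedding]
  have : ((extTree D k).neighborFinset u).map Fin.valEmbedding
      = (Finset.Ico (u.val - 1) (u.val + D)).erase u.val := by
    ext w
    simp only [Finset.mem_map, SimpleGraph.mem_neighborFinset, Fin.valEmbedding_apply,
      Finset.mem_erase, Finset.mem_Ico]
    constructor
    · rintro ⟨v, hv, rfl⟩
      rw [extTree_adj D k hD] at hv
      rcases hv with h | h
      · obtain ⟨h1, h2, h3, h4⟩ := h
        omega
      · exact absurd hu (rel_not_center D _ _ hD h)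
    · rintro ⟨h1, h2, h3⟩
      refine ⟨⟨w, by omega⟩, ?_, rfl⟩
      rw [extTree_adj D k hD]
      left
      exact ⟨hu, h1, (show u.val ≤ w + 1 by omega), h3⟩
  rw [this, Finset.card_erase_of_mem (by simp; omega), Nat.card_Ico]
  have : u.val ≠ 0 := by omega
  omega

open scoped Classical in
lemma extTree_degree_other (D k : ℕ) (hD : 4 ≤ D) (w : Fin (D * k + 1)) (hw : w.val % D ≠ 1) :
    (extTree D k).degree w ≤ 2 := by
  rw [← SimpleGraph.card_neighborFinset_eq_degree, ← Finset.card_map Fin.valEmbedding]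
  have : ((extTree D k).neighborFinset w).map Fin.valEmbedding ⊆ {w.val + 1, extPar D w.val} := by
    intro c
    simp only [Finset.mem_map, SimpleGraph.mem_neighborFinset, Fin.valEmbedding_apply,
      Finset.mem_insert, Finset.mem_singleton]
    rintro ⟨v, hv, rfl⟩
    rcases hv.2 with h | h
    · exact Or.inr h.2
    · left
      rw [extTree_adj D k hD] at hv
      have hr : extRel D v.val w.val := by
        rcases hv with h | h
        · exact absurd h.1 hw
        · exact h
      have := extPar_lt D v.val hD h.1
      have := hr.2.2.1
      omega
  exact (Finset.card_le_card this).trans Finset.card_le_two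

open scoped Classical in
/-- For `n = Δk + 1` there exists a tree of order `n` with maximum degree `Δ`
attaining `σ(T) = (4Δ−6)n + (Δ²−6Δ+3+6/Δ)(n−1)`; moreover any such tree has
`k(Δ−2)+2` leaves, `k−1` vertices of degree `2`, `k` vertices of degree `Δ`,
and every edge joins a vertex of degree `1` or `2` to a vertex of degree `Δ`. -/
theorem exists_extremal_tree_and_structure (Δ k : ℕ) (hΔ : 4 ≤ Δ) (hk : 1 ≤ k) :
    (∃ G : SimpleGraph (Fin (Δ * k + 1)), G.IsTree
        ∧ (∀ v, G.degree v ≤ Δ) ∧ (∃ v, G.degree v = Δ)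
        ∧ ∑ e ∈ G.edgeFinset,
            Sym2.lift ⟨fun u v => ((G.degree u : ℝ) - (G.degree v : ℝ)) ^ 2,
              by intro a b; ring⟩ e
          = (4 * (Δ : ℝ) - 6) * ((Δ * k + 1 : ℕ) : ℝ)
            + ((Δ : ℝ) ^ 2 - 6 * (Δ : ℝ) + 3 + 6 / (Δ : ℝ))
              * (((Δ * k + 1 : ℕ) : ℝ) - 1))
    ∧ (∀ (V : Type) (_ : Fintype V) (G : SimpleGraph V),
        Fintype.card V = Δ * k + 1 → G.IsTree →
        (∀ v, G.degree v ≤ Δ) → (∃ v, G.degree v = Δ) →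
        (∑ e ∈ G.edgeFinset,
            Sym2.lift ⟨fun u v => ((G.degree u : ℝ) - (G.degree v : ℝ)) ^ 2,
              by intro a b; ring⟩ e
          = (4 * (Δ : ℝ) - 6) * ((Δ * k + 1 : ℕ) : ℝ)
            + ((Δ : ℝ) ^ 2 - 6 * (Δ : ℝ) + 3 + 6 / (Δ : ℝ))
              * (((Δ * k + 1 : ℕ) : ℝ) - 1)) →
        (Finset.univ.filter (fun v => G.degree v = 1)).card = k * (Δ - 2) + 2
          ∧ (Finset.univ.filter (fun v => G.degree v = 2)).card = k - 1
          ∧ (Finset.univ.filter (fun v => G.degree v = Δ)).card = k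
          ∧ ∀ u v, G.Adj u v →
              ((G.degree u = 1 ∨ G.degree u = 2) ∧ G.degree v = Δ)
              ∨ ((G.degree v = 1 ∨ G.degree v = 2) ∧ G.degree u = Δ)) := by
  refine ⟨⟨extTree Δ k, ?_⟩, ?_⟩
  · have hT := extTree_isTree Δ k hΔ
    have hk1 : Δ ≤ Δ * k := Nat.le_mul_of_pos_right Δ hk
    haveI : Nontrivial (Fin (Δ * k + 1)) := Fin.nontrivial_iff_two_le.2 (by omega)
    have hpos : ∀ v, 1 ≤ (extTree Δ k).degree v := fun v =>
      hT.connected.preconnected.degree_pos_of_nontrivial v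
    have h12 : ∀ v : Fin (Δ * k + 1), v.val % Δ ≠ 1 →
        (extTree Δ k).degree v = 1 ∨ (extTree Δ k).degree v = 2 := by
      intro v hv
      have h1 := extTree_degree_other Δ k hΔ v hv
      have h2 := hpos v
      omega
    refine ⟨hT, ?_, ⟨⟨1, by omega⟩, extTree_degree_center Δ k hΔ _ (Nat.mod_eq_of_lt (show 1 < Δ by omega))⟩, ?_⟩
    · intro v
      by_cases hv : v.val % Δ = 1
      · exact (extTree_degree_center Δ k hΔ v hv).le
      · have h1 := extTree_degree_other Δ k hΔ v hv
        omega
    · have hs := sigma_gap (extTree Δ k) hT hpos (4 * (Δ : ℝ) - 6)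
        ((Δ : ℝ) ^ 2 - 6 * (Δ : ℝ) + 3 + 6 / (Δ : ℝ))
      rw [Finset.sum_eq_zero, Fintype.card_fin] at hs
      · linarith
      · intro e he
        induction e with
        | h a b =>
          rw [SimpleGraph.mem_edgeFinset, SimpleGraph.mem_edgeSet, extTree_adj Δ k hΔ] at he
          simp only [Sym2.lift_mk]
          apply gap_zero Δ _ _ hΔ
          rcases he with h | h
          · right
            exact ⟨h12 b (rel_not_center Δ _ _ hΔ h), extTree_degree_center Δ k hΔ a h.1⟩
          · left
            exact ⟨h12 a (rel_not_center Δ _ _ hΔ h), extTree_degree_center Δ k hΔ b h.1⟩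
  · intro V _ G hc hT hle _ hσ
    have hk1 : Δ ≤ Δ * k := Nat.le_mul_of_pos_right Δ hk
    haveI : Nontrivial V := Fintype.one_lt_card_iff_nontrivial.1 (by omega)
    have hpos : ∀ v, 1 ≤ G.degree v := fun v =>
      hT.connected.preconnected.degree_pos_of_nontrivial v
    have hs := sigma_gap G hT hpos (4 * (Δ : ℝ) - 6)
        ((Δ : ℝ) ^ 2 - 6 * (Δ : ℝ) + 3 + 6 / (Δ : ℝ))
    rw [hσ, hc, sub_self, Finset.sum_eq_zero_iff_of_nonneg] at hs
    · have hadj : ∀ u v, G.Adj u v →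
          ((G.degree u = 1 ∨ G.degree u = 2) ∧ G.degree v = Δ)
          ∨ ((G.degree v = 1 ∨ G.degree v = 2) ∧ G.degree u = Δ) := by
        intro u v huv
        have h := hs s(u, v) (by rw [SimpleGraph.mem_edgeFinset, SimpleGraph.mem_edgeSet]; exact huv)
        simp only [Sym2.lift_mk] at h
        exact (gap_full Δ _ _ hΔ (hpos u) (hpos v) (hle u) (hle v)).2 h
      obtain ⟨h1, h2, h3⟩ := tree_structure Δ k hΔ hk V G hc hT hpos hadj
      exact ⟨h1, h2, h3, hadj⟩
    · intro e _
      induction e with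
      | h a b =>
        simp only [Sym2.lift_mk]
        exact (gap_full Δ _ _ hΔ (hpos a) (hpos b) (hle a) (hle b)).1
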